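/- There exists a universal constant c > 0 such that the following holds. Let d ≥ 2, let W ≥ d, let W_max ≥ 1, and let f₁, f₂ : ℝ^d → ℝ be two two-hidden-layer tanh neural networks on ℝ^d with hidden widths W whose maximal weights are at most W_max. Then for every subset S ⊆ {1, …, d}, the mixed partial derivative of the product f₁·f₂ taken once with respect to each coordinate in S satisfies sup_{x ∈ [−1,1]^d} | ∂^{|S|}(f₁·f₂)/∂x_S (x) | ≤ 2^{c·(d·log(d·W·W_max) + d²·log d)}. -/

import Mathlib

/-- Mixed partial derivative of `f` taken successively in the coordinate directions
listed in `L` (using the Fréchet derivative in the direction of the standard basis vectors). -/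
noncomputable def mixedDeriv {d : ℕ} {E : Type*} [NormedAddCommGroup E] [NormedSpace ℝ E] :
    List (Fin d) → ((Fin d → ℝ) → E) → ((Fin d → ℝ) → E)
  | [] => fun f => f
  | i :: L => fun f x => fderiv ℝ (mixedDeriv L f) x (Pi.single i 1)

/-- A two-hidden-layer tanh neural network on `ℝ^d` with hidden widths `W₁` and `W₂`. -/
structure TanhNet (d W₁ W₂ : ℕ) where
  Win : Fin W₁ → Fin d → ℝ
  bin : Fin W₁ → ℝ
  Whid : Fin W₂ → Fin W₁ → ℝ
  bhid : Fin W₂ → ℝ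
  Wout : Fin W₂ → ℝ
  bout : ℝ

/-- Evaluation of a two-hidden-layer tanh neural network:
`f(x) = W_out · tanh(W_hidden · tanh(W_in · x + b_in) + b_hidden) + b_out`. -/
noncomputable def TanhNet.eval {d W₁ W₂ : ℕ} (net : TanhNet d W₁ W₂) (x : Fin d → ℝ) : ℝ :=
  (∑ i, net.Wout i *
      Real.tanh ((∑ j, net.Whid i j *
        Real.tanh ((∑ l, net.Win j l * x l) + net.bin j)) + net.bhid i)) + net.bout

/-- All weights and biases of the network are bounded in absolute value by `M`,
i.e. the maximal weight of the network is at most `M`. -/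
def TanhNet.WeightsLe {d W₁ W₂ : ℕ} (net : TanhNet d W₁ W₂) (M : ℝ) : Prop :=
  (∀ i j, |net.Win i j| ≤ M) ∧ (∀ i, |net.bin i| ≤ M) ∧
  (∀ i j, |net.Whid i j| ≤ M) ∧ (∀ i, |net.bhid i| ≤ M) ∧
  (∀ i, |net.Wout i| ≤ M) ∧ |net.bout| ≤ M

theorem Real.contDiff_tanh {n : WithTop ℕ∞} : ContDiff ℝ n Real.tanh := by
  have h : Real.tanh = fun x => Real.sinh x / Real.cosh x :=
    funext Real.tanh_eq_sinh_div_cosh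
  rw [h]
  exact Real.contDiff_sinh.div Real.contDiff_cosh fun x => (Real.cosh_pos x).ne'

theorem Real.deriv_tanh : deriv Real.tanh = fun x => 1 - Real.tanh x * Real.tanh x := by
  have h : Real.tanh = fun x => Real.sinh x / Real.cosh x :=
    funext Real.tanh_eq_sinh_div_cosh
  funext x
  have hc := (Real.cosh_pos x).ne'
  rw [h, ((Real.hasDerivAt_sinh x).fun_div (Real.hasDerivAt_cosh x) hc).deriv]
  field_simp

/-- The `k`-th derivative of `tanh` is bounded by `k!`. -/
theorem Real.norm_iteratedFDeriv_tanh_le (k : ℕ) (x : ℝ) :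
    ‖iteratedFDeriv ℝ k Real.tanh x‖ ≤ (k.factorial : ℝ) := by
  induction k using Nat.strong_induction_on generalizing x with
  | _ k ih =>
    rcases k with _ | k
    · simpa using (Real.abs_tanh_lt_one x).le
    rw [norm_iteratedFDeriv_eq_norm_iteratedDeriv, iteratedDeriv_succ', Real.deriv_tanh]
    rcases k with _ | k
    · simp only [iteratedDeriv_zero, zero_add, Nat.factorial_one, Nat.cast_one, Real.norm_eq_abs]
      have h := Real.tanh_sq_lt_one x
      rw [abs_le]
      constructor <;> nlinarith [sq_nonneg (Real.tanh x)]
    rw [iteratedDeriv_const_sub (Nat.succ_pos k), iteratedDeriv_neg, norm_neg,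
      ← norm_iteratedFDeriv_eq_norm_iteratedDeriv]
    refine (norm_iteratedFDeriv_mul_le (N := (k + 1 : ℕ)) Real.contDiff_tanh Real.contDiff_tanh x
      le_rfl).trans ?_
    calc _ ≤ ∑ i ∈ Finset.range (k + 1 + 1), ((k + 1).factorial : ℝ) := by
          refine Finset.sum_le_sum fun i hi => ?_
          have hi' : i ≤ k + 1 := Nat.lt_succ_iff.mp (Finset.mem_range.mp hi)
          calc _ ≤ ((k + 1).choose i : ℝ) * (i.factorial : ℝ) * ((k + 1 - i).factorial : ℝ) := by
                gcongr
                · exact ih i (by omega) x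
                · exact ih (k + 1 - i) (by omega) x
            _ = ((k + 1).factorial : ℝ) := by
                exact_mod_cast Nat.choose_mul_factorial_mul_factorial hi'
      _ = ((k + 1 + 1).factorial : ℝ) := by
          rw [Finset.sum_const, Finset.card_range, nsmul_eq_mul, Nat.factorial_succ (k + 1)]
          push_cast
          ring

theorem mixedDeriv_eq_iteratedFDeriv {d : ℕ} {E : Type*} [NormedAddCommGroup E] [NormedSpace ℝ E]
    {f : (Fin d → ℝ) → E} (L : List (Fin d)) (hf : ContDiff ℝ L.length f) :
    mixedDeriv L f = fun x =>
      iteratedFDeriv ℝ L.length f x (fun k => Pi.single (L.get k) 1) := by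
  induction L with
  | nil => ext x; simp [mixedDeriv]
  | cons i L ih =>
    have hlt : (L.length : WithTop ℕ∞) < ((i :: L).length : ℕ) := by
      exact_mod_cast Nat.lt_succ_self _
    ext x
    simp only [mixedDeriv]
    rw [ih (hf.of_le hlt.le)]
    exact (DifferentiableAt.iteratedFDeriv_succ_apply_left'
      (m := fun k => Pi.single ((i :: L).get k) 1)
      ((hf.differentiable_iteratedFDeriv hlt) x)).symm

theorem norm_mixedDeriv_le {d : ℕ} {E : Type*} [NormedAddCommGroup E] [NormedSpace ℝ E]
    {f : (Fin d → ℝ) → E} (L : List (Fin d)) (hf : ContDiff ℝ L.length f) (x : Fin d → ℝ) :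
    ‖mixedDeriv L f x‖ ≤ ‖iteratedFDeriv ℝ L.length f x‖ := by
  rw [mixedDeriv_eq_iteratedFDeriv L hf]
  refine (ContinuousMultilinearMap.le_opNorm _ _).trans_eq ?_
  simp [Pi.norm_single]

theorem norm_iteratedFDeriv_affine_le {ι : Type*} [Fintype ι] {w : ι → ℝ} {M : ℝ} (hM : 0 ≤ M)
    (hw : ∀ l, |w l| ≤ M) (b : ℝ) {k : ℕ} (hk : 1 ≤ k) (x : ι → ℝ) :
    ‖iteratedFDeriv ℝ k (fun y : ι → ℝ => (∑ l, w l * y l) + b) x‖ ≤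
      (Fintype.card ι * M) ^ k := by
  let A : (ι → ℝ) →L[ℝ] ℝ := ∑ l, w l • ContinuousLinearMap.proj l
  have hA : (fun y : ι → ℝ => (∑ l, w l * y l) + b) = fun y => A y + b := by
    ext y; simp [A]
  have hfd : fderiv ℝ (fun y => A y + b) = fun _ => A := by
    ext1 y; rw [fderiv_add_const, A.fderiv]
  have hnorm : ‖A‖ ≤ Fintype.card ι * M := by
    refine A.opNorm_le_bound (by positivity) fun y => ?_
    calc ‖A y‖ = ‖∑ l, w l * y l‖ := by simp [A]
      _ ≤ ∑ l, ‖w l * y l‖ := norm_sum_le _ _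
      _ ≤ ∑ _l : ι, M * ‖y‖ := by
          refine Finset.sum_le_sum fun l _ => ?_
          rw [norm_mul]
          exact mul_le_mul (hw l) (norm_le_pi_norm y l) (norm_nonneg _) hM
      _ = Fintype.card ι * M * ‖y‖ := by simp [mul_assoc]
  obtain ⟨k, rfl⟩ := Nat.exists_eq_add_of_le' hk
  rw [hA, ← norm_iteratedFDeriv_fderiv, hfd]
  rcases k with _ | k
  · simpa using hnorm
  · rw [iteratedFDeriv_succ_const]
    simp only [Pi.zero_apply, norm_zero]
    positivity

theorem norm_iteratedFDeriv_sum_mul_le {E ι : Type*} [NormedAddCommGroup E] [NormedSpace ℝ E]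
    [Fintype ι] {a : ι → ℝ} {M C : ℝ} (ha : ∀ j, |a j| ≤ M) {g : ι → E → ℝ} {k : ℕ}
    (hg : ∀ j, ContDiff ℝ k (g j)) {x : E} (hC : ∀ j, ‖iteratedFDeriv ℝ k (g j) x‖ ≤ C) :
    ‖iteratedFDeriv ℝ k (fun y => ∑ j, a j * g j y) x‖ ≤ Fintype.card ι * (M * C) := by
  rw [iteratedFDeriv_fun_sum_apply fun j _ => (contDiff_const.mul (hg j)).contDiffAt]
  refine (norm_sum_le _ _).trans ?_
  calc _ ≤ ∑ _j : ι, M * C := by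
        refine Finset.sum_le_sum fun j _ => ?_
        have h := iteratedFDeriv_const_smul_apply' (a := a j) (hg j).contDiffAt (x := x)
        simp only [smul_eq_mul] at h
        rw [h, norm_smul]
        exact mul_le_mul (ha j) (hC j) (norm_nonneg _) ((abs_nonneg _).trans (ha j))
    _ = _ := by simp

theorem iteratedFDeriv_add_const_of_ne_zero {E : Type*} [NormedAddCommGroup E] [NormedSpace ℝ E]
    {g : E → ℝ} {k : ℕ} (hg : ContDiff ℝ k g) (hk : k ≠ 0) (b : ℝ) (x : E) :
    iteratedFDeriv ℝ k (fun y => g y + b) x = iteratedFDeriv ℝ k g x := by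
  rw [fun_iteratedFDeriv_add_apply hg.contDiffAt contDiffAt_const, iteratedFDeriv_const_of_ne hk]
  simp

theorem norm_iteratedFDeriv_add_const_le {E : Type*} [NormedAddCommGroup E] [NormedSpace ℝ E]
    {g : E → ℝ} {k : ℕ} (hg : ContDiff ℝ k g) (b : ℝ) (x : E) :
    ‖iteratedFDeriv ℝ k (fun y => g y + b) x‖ ≤ ‖iteratedFDeriv ℝ k g x‖ + |b| := by
  rcases eq_or_ne k 0 with rfl | hk
  · simpa using abs_add_le (g x) b
  · rw [iteratedFDeriv_add_const_of_ne_zero hg hk]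
    linarith [abs_nonneg b]

/-- Faà di Bruno bound for `tanh ∘ u`. -/
theorem norm_iteratedFDeriv_tanh_comp_le {E : Type*} [NormedAddCommGroup E] [NormedSpace ℝ E]
    {u : E → ℝ} {n d : ℕ} (hn : n ≤ d) (hu : ContDiff ℝ n u) {D : ℝ} (hD : 0 ≤ D) {x : E}
    (h : ∀ k, 1 ≤ k → k ≤ n → ‖iteratedFDeriv ℝ k u x‖ ≤ D ^ k) :
    ‖iteratedFDeriv ℝ n (fun y => Real.tanh (u y)) x‖ ≤ (d.factorial : ℝ) ^ 2 * D ^ n := by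
  refine (norm_iteratedFDeriv_comp_le (g := Real.tanh) (C := (d.factorial : ℝ)) (D := D)
    Real.contDiff_tanh hu le_rfl x (fun i hi => ?_) h).trans ?_
  · exact (Real.norm_iteratedFDeriv_tanh_le i _).trans
      (by exact_mod_cast Nat.factorial_le (hi.trans hn))
  · rw [sq]
    gcongr

theorem TanhNet.contDiff_eval {d W₁ W₂ : ℕ} (net : TanhNet d W₁ W₂) {n : WithTop ℕ∞} :
    ContDiff ℝ n net.eval := by
  unfold TanhNet.eval
  refine (ContDiff.sum fun i _ => contDiff_const.mul (Real.contDiff_tanh.comp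
    ((ContDiff.sum fun j _ => contDiff_const.mul (Real.contDiff_tanh.comp ?_)).add
      contDiff_const))).add contDiff_const
  fun_prop

theorem TanhNet.norm_iteratedFDeriv_eval_le {d W : ℕ} (hd : 1 ≤ d) (hW : 1 ≤ W) {M : ℝ}
    (hM : 1 ≤ M) {net : TanhNet d W W} (hnet : net.WeightsLe M) {n : ℕ} (hn : n ≤ d)
    (x : Fin d → ℝ) :
    ‖iteratedFDeriv ℝ n net.eval x‖ ≤
      2 * W * M * (d.factorial : ℝ) ^ 2 *
        (W * M * (d.factorial : ℝ) ^ 2 * (d * M)) ^ d := by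
  obtain ⟨hin, -, hhid, -, hout, hbout⟩ := hnet
  have hF : (1 : ℝ) ≤ d.factorial := by exact_mod_cast Nat.succ_le_of_lt d.factorial_pos
  have hd' : (1 : ℝ) ≤ d := by exact_mod_cast hd
  have hW' : (1 : ℝ) ≤ W := by exact_mod_cast hW
  have hM0 : 0 ≤ M := by linarith
  have hF2 : (1 : ℝ) ≤ (d.factorial : ℝ) ^ 2 := one_le_pow₀ hF
  have hK : (1 : ℝ) ≤ W * M * (d.factorial : ℝ) ^ 2 :=
    one_le_mul_of_one_le_of_one_le (one_le_mul_of_one_le_of_one_le hW' hM) hF2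
  set D : ℝ := W * M * (d.factorial : ℝ) ^ 2 * (d * M) with hDdef
  have hD : 1 ≤ D := one_le_mul_of_one_le_of_one_le hK (one_le_mul_of_one_le_of_one_le hd' hM)
  have hu (j : Fin W) : ContDiff ℝ ⊤ fun y : Fin d → ℝ => (∑ l, net.Win j l * y l) + net.bin j := by
    fun_prop
  have hv (i : Fin W) : ContDiff ℝ ⊤ fun y : Fin d → ℝ => ∑ j, net.Whid i j *
      Real.tanh ((∑ l, net.Win j l * y l) + net.bin j) :=
    ContDiff.sum fun j _ => contDiff_const.mul (Real.contDiff_tanh.comp (hu j))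
  have hhidden (i : Fin W) (k : ℕ) (hk : 1 ≤ k) (hkd : k ≤ d) :
      ‖iteratedFDeriv ℝ k (fun y : Fin d → ℝ => (∑ j, net.Whid i j *
        Real.tanh ((∑ l, net.Win j l * y l) + net.bin j)) + net.bhid i) x‖ ≤ D ^ k := by
    rw [iteratedFDeriv_add_const_of_ne_zero ((hv i).of_le le_top) (by omega)]
    have h := norm_iteratedFDeriv_sum_mul_le (hhid i) (x := x)
      (fun j => Real.contDiff_tanh.comp ((hu j).of_le le_top) (n := k)) (fun j =>
      norm_iteratedFDeriv_tanh_comp_le hkd ((hu j).of_le le_top) (D := d * M) (by positivity)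
        fun m hm _ => by simpa using norm_iteratedFDeriv_affine_le hM0 (hin j) (net.bin j) hm x)
    refine h.trans ?_
    rw [Fintype.card_fin, hDdef, mul_pow _ (d * M)]
    calc _ = (W * M * (d.factorial : ℝ) ^ 2) * (d * M) ^ k := by ring
      _ ≤ _ := by
        gcongr
        exact le_self_pow₀ hK (by omega)
  have hsum : ContDiff ℝ ⊤ fun y : Fin d → ℝ => ∑ i, net.Wout i *
      Real.tanh ((∑ j, net.Whid i j *
        Real.tanh ((∑ l, net.Win j l * y l) + net.bin j)) + net.bhid i) :=
    ContDiff.sum fun i _ => contDiff_const.mul (Real.contDiff_tanh.comp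
      ((hv i).add contDiff_const))
  have h := norm_iteratedFDeriv_sum_mul_le hout (x := x)
    (fun i => Real.contDiff_tanh.comp (((hv i).add contDiff_const).of_le le_top) (n := n))
    (fun i => norm_iteratedFDeriv_tanh_comp_le hn (((hv i).add contDiff_const).of_le le_top)
      (by positivity) fun k hk hkn => hhidden i k hk (hkn.trans hn))
  refine (norm_iteratedFDeriv_add_const_le (hsum.of_le le_top) net.bout x).trans ?_
  refine (add_le_add h hbout).trans ?_
  rw [Fintype.card_fin]
  have hpow : D ^ n ≤ D ^ d := pow_le_pow_right₀ hD hn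
  have hD1 : 1 ≤ D ^ d := one_le_pow₀ hD
  calc W * (M * ((d.factorial : ℝ) ^ 2 * D ^ n)) + M
      ≤ W * (M * ((d.factorial : ℝ) ^ 2 * D ^ d)) + W * (M * ((d.factorial : ℝ) ^ 2 * D ^ d)) := by
        gcongr
        calc M = 1 * (M * (1 * 1)) := by ring
          _ ≤ _ := by gcongr
    _ = _ := by ring

theorem norm_iteratedFDeriv_mul_le_two_pow {E : Type*} [NormedAddCommGroup E] [NormedSpace ℝ E]
    {f g : E → ℝ} {n : ℕ} (hf : ContDiff ℝ n f) (hg : ContDiff ℝ n g) {x : E} {B : ℝ}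
    (hfB : ∀ k ≤ n, ‖iteratedFDeriv ℝ k f x‖ ≤ B) (hgB : ∀ k ≤ n, ‖iteratedFDeriv ℝ k g x‖ ≤ B) :
    ‖iteratedFDeriv ℝ n (fun y => f y * g y) x‖ ≤ 2 ^ n * B ^ 2 := by
  have hB : 0 ≤ B := (norm_nonneg _).trans (hfB 0 n.zero_le)
  calc _ ≤ _ := norm_iteratedFDeriv_mul_le hf hg x le_rfl
    _ ≤ ∑ i ∈ Finset.range (n + 1), (n.choose i : ℝ) * B * B := by
        refine Finset.sum_le_sum fun i hi => ?_
        gcongr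
        · exact hfB i (Nat.lt_succ_iff.mp (Finset.mem_range.mp hi))
        · exact hgB _ (Nat.sub_le _ _)
    _ = 2 ^ n * B ^ 2 := by
        rw [← Finset.sum_mul, ← Finset.sum_mul, ← Nat.cast_sum, Nat.sum_range_choose]
        push_cast
        ring

theorem two_pow_mul_tanhNet_bound_sq_le {d W : ℕ} (hd : 2 ≤ d) (hW : 1 ≤ W) {M : ℝ}
    (hM : 1 ≤ M) :
    2 ^ d * (2 * W * M * (d.factorial : ℝ) ^ 2 *
        (W * M * (d.factorial : ℝ) ^ 2 * (d * M)) ^ d) ^ 2 ≤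
      (d * W * M) ^ (11 * d) * (d : ℝ) ^ (4 * d ^ 2) := by
  have hd' : (2 : ℝ) ≤ d := by exact_mod_cast hd
  have hW' : (1 : ℝ) ≤ W := by exact_mod_cast hW
  have hM0 : 0 < M := by linarith
  set T : ℝ := d * W * M with hT
  have hWM : 1 ≤ W * M := one_le_mul_of_one_le_of_one_le hW' hM
  have hdT : (d : ℝ) ≤ T := by
    rw [hT, mul_assoc]
    exact le_mul_of_one_le_right (by positivity) hWM
  have hT1 : 1 ≤ T := by linarith
  have hF : (d.factorial : ℝ) ≤ (d : ℝ) ^ d := by exact_mod_cast d.factorial_le_pow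
  have h2WM : 2 * W * M ≤ T := by
    rw [hT]
    gcongr
  have hbase : W * M * (d * M) ≤ T ^ 2 := by
    rw [hT]
    calc W * M * (d * M) = 1 * 1 * (d * W * M ^ 2) := by ring
      _ ≤ d * W * (d * W * M ^ 2) := by
        gcongr
        linarith
      _ = _ := by ring
  calc 2 ^ d * (2 * W * M * (d.factorial : ℝ) ^ 2 *
        (W * M * (d.factorial : ℝ) ^ 2 * (d * M)) ^ d) ^ 2
      = 2 ^ d * (2 * W * M) ^ 2 * (d.factorial : ℝ) ^ 4 * (W * M * (d * M)) ^ (2 * d) *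
          (d.factorial : ℝ) ^ (4 * d) := by ring
    _ ≤ T ^ d * T ^ 2 * ((T : ℝ) ^ d) ^ 4 * (T ^ 2) ^ (2 * d) * ((d : ℝ) ^ d) ^ (4 * d) := by
        gcongr
        · linarith
        · exact hF.trans (by gcongr)
    _ = T ^ (9 * d + 2) * (d : ℝ) ^ (4 * d ^ 2) := by ring
    _ ≤ T ^ (11 * d) * (d : ℝ) ^ (4 * d ^ 2) := by
        gcongr
        · omega

/-- **Bound on the mixed derivatives of a product of two tanh neural networks.**
There is a universal constant `c > 0` such that for any `d ≥ 2`, hidden widths `W ≥ d`,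
maximal weight bound `W_max ≥ 1`, two two-hidden-layer tanh networks `f₁, f₂` with
weights bounded by `W_max`, and any subset `S` of the coordinates, the mixed partial
derivative of `f₁·f₂` taken once with respect to each coordinate in `S` is bounded on
`[−1,1]^d` by `2^{c (d log(d·W·W_max) + d² log d)}`. -/
theorem prod_tanhNet_mixedDeriv_bound :
    ∃ c : ℝ, 0 < c ∧
      ∀ (d W : ℕ), 2 ≤ d → d ≤ W → ∀ Wmax : ℝ, 1 ≤ Wmax →
        ∀ (f₁ f₂ : TanhNet d W W), f₁.WeightsLe Wmax → f₂.WeightsLe Wmax →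
          ∀ (S : Finset (Fin d)) (x : Fin d → ℝ), (∀ i, x i ∈ Set.Icc (-1 : ℝ) 1) →
            |mixedDeriv S.toList (fun y => f₁.eval y * f₂.eval y) x| ≤
              (2 : ℝ) ^ (c * ((d : ℝ) * Real.log ((d : ℝ) * (W : ℝ) * Wmax) +
                (d : ℝ) ^ 2 * Real.log (d : ℝ))) := by
  have hlog2 : 0 < Real.log 2 := Real.log_pos one_lt_two
  refine ⟨11 / Real.log 2, by positivity, ?_⟩
  intro d W hd hW M hM f₁ f₂ h₁ h₂ S x _
  have hcard : S.toList.length ≤ d := by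
    simpa using S.card_le_univ
  have hd' : (2 : ℝ) ≤ d := by exact_mod_cast hd
  have hW' : (0 : ℝ) < W := by exact_mod_cast (by omega : 0 < W)
  have hT : 0 < (d : ℝ) * W * M := by positivity
  have hlogd : 0 ≤ Real.log d := Real.log_nonneg (by linarith)
  rw [← Real.norm_eq_abs]
  calc _ ≤ _ := norm_mixedDeriv_le _ (f₁.contDiff_eval.mul f₂.contDiff_eval) x
    _ ≤ _ := norm_iteratedFDeriv_mul_le_two_pow f₁.contDiff_eval f₂.contDiff_eval
        (fun k hk => TanhNet.norm_iteratedFDeriv_eval_le (by omega) (by omega) hM h₁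
          (hk.trans hcard) x)
        (fun k hk => TanhNet.norm_iteratedFDeriv_eval_le (by omega) (by omega) hM h₂
          (hk.trans hcard) x)
    _ ≤ 2 ^ d * _ := by
        gcongr
        exact one_le_two
    _ ≤ _ := two_pow_mul_tanhNet_bound_sq_le hd (by omega) hM
    _ = Real.exp (11 * d * Real.log (d * W * M) + 4 * d ^ 2 * Real.log d) := by
        have h₁₁ := Real.exp_nat_mul (Real.log (d * W * M)) (11 * d)
        have h₄ := Real.exp_nat_mul (Real.log d) (4 * d ^ 2)
        rw [Real.exp_log hT] at h₁₁
        rw [Real.exp_log (by linarith)] at h₄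
        push_cast at h₁₁ h₄
        rw [Real.exp_add, h₁₁, h₄]
    _ ≤ Real.exp (11 * (d * Real.log (d * W * M) + d ^ 2 * Real.log d)) := by
        have := mul_nonneg (sq_nonneg (d : ℝ)) hlogd
        gcongr
        linarith
    _ = _ := by
        rw [Real.rpow_def_of_pos two_pos]
        congr 1
        field_simp
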